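/- arXiv:1203.4115 — 9 statements merged into one kernel-verified Lean document; each statement's English description precedes it below -/
import Mathlib

section
/- Let ε₀ > 0, T₀ > 0, let f, R : ℝ → ℝ, and let x₀ : ℝ → ℝ be a differentiable T₀-periodic function (x₀(t + T₀) = x₀(t) for all t) satisfying ε₀·x₀′(t) = −x₀(t) + f(x₀(t − 1 − ε₀·R(x₀(t)))) for all t ∈ ℝ. Then for every natural number n, the function xₙ(t) := x₀((1 + n·T₀)·t) is periodic with period T₀/(1 + n·T₀) and satisfies εₙ·xₙ′(t) = −xₙ(t) + f(xₙ(t − 1 − εₙ·R(xₙ(t)))) for all t ∈ ℝ, where εₙ := ε₀/(1 + n·T₀). -/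
/-- Cooke's rescaling argument: a `T₀`-periodic solution of the state-dependent
DDE `ε₀·x′(t) = −x(t) + f(x(t − 1 − ε₀·R(x(t))))` generates, for every `n : ℕ`,
a `T₀/(1+n·T₀)`-periodic solution of the same equation with parameter
`εₙ = ε₀/(1+n·T₀)`. -/
theorem cooke_rescaling
    (ε₀ T₀ : ℝ) (hε₀ : 0 < ε₀) (hT₀ : 0 < T₀)
    (f R : ℝ → ℝ) (x₀ : ℝ → ℝ)
    (hdiff : Differentiable ℝ x₀)
    (hper : ∀ t : ℝ, x₀ (t + T₀) = x₀ t)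
    (hdde : ∀ t : ℝ, ε₀ * deriv x₀ t = -x₀ t + f (x₀ (t - 1 - ε₀ * R (x₀ t)))) :
    ∀ n : ℕ,
      (∀ t : ℝ, x₀ ((1 + n * T₀) * (t + T₀ / (1 + n * T₀))) = x₀ ((1 + n * T₀) * t)) ∧
      (∀ t : ℝ,
        (ε₀ / (1 + n * T₀)) * deriv (fun s => x₀ ((1 + n * T₀) * s)) t =
          -x₀ ((1 + n * T₀) * t) +
            f (x₀ ((1 + n * T₀) *
              (t - 1 - (ε₀ / (1 + n * T₀)) * R (x₀ ((1 + n * T₀) * t)))))) := by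
  intro n
  have hc : (0 : ℝ) < 1 + n * T₀ := by positivity
  have hc0 : (1 + n * T₀ : ℝ) ≠ 0 := hc.ne'
  refine ⟨fun t => ?_, fun t => ?_⟩
  · rw [mul_add, mul_div_cancel₀ _ hc0, hper]
  · have hd : deriv (fun s => x₀ ((1 + n * T₀) * s)) t
        = (1 + n * T₀) * deriv x₀ ((1 + n * T₀) * t) := by
      have h := deriv_comp_mul_left (1 + n * T₀ : ℝ) x₀ t
      simpa [smul_eq_mul] using h
    have hp : Function.Periodic x₀ T₀ := hper
    have hx := hp.sub_nat_mul_eq n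
      (x := (1 + n * T₀) * t - 1 - ε₀ * R (x₀ ((1 + n * T₀) * t)))
    have e : (1 + n * T₀) * (t - 1 - (ε₀ / (1 + n * T₀)) * R (x₀ ((1 + n * T₀) * t)))
        = (1 + n * T₀) * t - 1 - ε₀ * R (x₀ ((1 + n * T₀) * t)) - n * T₀ := by
      generalize R (x₀ ((1 + n * T₀) * t)) = r
      field_simp
      ring
    rw [hd, e, hx, ← hdde, ← mul_assoc, div_mul_cancel₀ _ hc0]
end

section
/- Let f : ℝ → ℝ be continuous, let r : ℝ → ℝ be Lipschitz continuous and nonnegative, let ε > 0, and let x : ℝ → ℝ be differentiable and satisfy ε·x′(t) = −x(t) + f(x(t − r(x(t)))) for all t ∈ ℝ. Suppose there exist real numbers a₀ < a₁ and times t₀ < t₁ < t₂ < t₃ such that x(tᵢ) ≤ a₀ for i = 0, 2 and x(tᵢ) ≥ a₁ for i = 1, 3. Then sup_{u ∈ [a₀,a₁]} r(u) − inf_{u ∈ [a₀,a₁]} r(u) ≤ 3·(t₃ − t₀). -/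
/-- If `x ≤ x t` just to the left of `t`, then the derivative at `t` is nonnegative. -/
lemma mpn_deriv_nonneg {x : ℝ → ℝ} (hx : Differentiable ℝ x) {a t : ℝ} (hat : a < t)
    (h : ∀ t', a < t' → t' < t → x t' ≤ x t) : 0 ≤ deriv x t := by
  have h1 := (hasDerivAt_iff_tendsto_slope.mp (hx t).hasDerivAt).mono_left
    (nhdsWithin_mono t (show Set.Iio t ⊆ {t}ᶜ from fun y hy => ne_of_lt hy))
  refine ge_of_tendsto h1 ?_
  filter_upwards [Ioo_mem_nhdsLT hat] with y hy
  rw [slope_def_field]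
  exact div_nonneg_of_nonpos (by linarith [h y hy.1 hy.2]) (by linarith [hy.2])

/-- Left limits preserve upper bounds. -/
lemma mpn_le_of_left {x : ℝ → ℝ} (hx : Continuous x) {a t b : ℝ} (hat : a < t)
    (h : ∀ t', a < t' → t' < t → x t' ≤ b) : x t ≤ b := by
  refine le_of_tendsto ((hx.tendsto t).mono_left nhdsWithin_le_nhds : 
    Filter.Tendsto x (nhdsWithin t (Set.Iio t)) _) ?_
  filter_upwards [Ioo_mem_nhdsLT hat] with y hy
  exact h y hy.1 hy.2

lemma mpn_strict (f r : ℝ → ℝ) (hr : Continuous r)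
    (ε : ℝ) (hε : 0 < ε) (x : ℝ → ℝ) (hx : Differentiable ℝ x)
    (hdde : ∀ t : ℝ, ε * deriv x t = -x t + f (x (t - r (x t))))
    (b₀ b₁ : ℝ) (hb : b₀ < b₁) (t₀ t₁ t₂ : ℝ) (h01 : t₀ < t₁) (h12 : t₁ < t₂)
    (hx0 : x t₀ ≤ b₀) (hx1 : b₁ < x t₁) (hx2 : x t₂ ≤ b₀) :
    r b₀ - r b₁ ≤ t₂ - t₀ := by
  by_contra! hlt
  have hxc := hx.continuous
  -- first time at which `x` reaches `b₁`
  obtain ⟨σ, ⟨⟨hσ0, hσ1⟩, hσx⟩, hσmin⟩ : ∃ σ, IsLeast (Set.Icc t₀ t₁ ∩ {t | b₁ ≤ x t}) σ :=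
    (isCompact_Icc.inter_right (isClosed_le continuous_const hxc)).exists_isLeast
      ⟨t₁, ⟨h01.le, le_rfl⟩, hx1.le⟩
  simp only [Set.mem_ofPred_eq] at hσx
  have hσ0' : t₀ < σ := lt_of_le_of_ne hσ0 (by rintro rfl; linarith)
  have hbefore : ∀ t', t₀ < t' → t' < σ → x t' ≤ b₁ := by
    intro t' h1 h2
    by_contra! h3
    have := hσmin ⟨⟨h1.le, by linarith⟩, h3.le⟩
    linarith
  have hσeq : x σ = b₁ := le_antisymm (mpn_le_of_left hxc hσ0' hbefore) hσx
  have hσd : 0 ≤ deriv x σ := mpn_deriv_nonneg hx hσ0' (by rwa [hσeq])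
  have hgs : b₁ ≤ f (x (σ - r b₁)) := by
    have := hdde σ
    rw [hσeq] at this
    have := mul_nonneg hε.le hσd
    linarith
  -- compact set of admissible (time, level) pairs
  let Q : Set (ℝ × ℝ) := (Set.Icc t₁ t₂ ×ˢ Set.Icc b₀ b₁) ∩
    {p | x p.1 ≤ p.2 ∧ p.1 - r p.2 ≤ σ - r b₁}
  have hQ : IsCompact Q := by
    refine (isCompact_Icc.prod isCompact_Icc).inter_right ?_
    have c1 : IsClosed {p : ℝ × ℝ | x p.1 ≤ p.2} :=
      isClosed_le (hxc.comp continuous_fst) continuous_snd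
    have c2 : IsClosed {p : ℝ × ℝ | p.1 - r p.2 ≤ σ - r b₁} :=
      isClosed_le (continuous_fst.sub (hr.comp continuous_snd)) continuous_const
    exact c1.inter c2
  have hQn : Q.Nonempty := ⟨(t₂, b₀), ⟨⟨h12.le, le_rfl⟩, ⟨le_rfl, hb.le⟩⟩, hx2, by
    show t₂ - r b₀ ≤ σ - r b₁
    linarith⟩
  obtain ⟨⟨t, u⟩, ⟨⟨⟨ht1, ht2⟩, ⟨hu0, hu1⟩⟩, hxu, hts⟩, hmin⟩ :=
    hQ.exists_isMinOn hQn continuous_fst.continuousOn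
  have hmin' : ∀ t' u', (t', u') ∈ Q → t ≤ t' := fun t' u' h => hmin h
  dsimp only at ht1 ht2 hu0 hu1 hxu hts
  have ht1' : t₁ < t := lt_of_le_of_ne ht1 (by rintro rfl; linarith)
  have hu1' : u < b₁ := lt_of_le_of_ne hu1 (by rintro rfl; linarith)
  have hgt : ∀ t', t₁ < t' → t' < t → u < x t' := by
    intro t' h1 h2
    by_contra! h3
    have := hmin' t' u ⟨⟨⟨h1.le, by dsimp; linarith⟩, ⟨hu0, hu1⟩⟩, h3, by dsimp; linarith⟩
    linarith
  have hxt : x t = u := by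
    refine le_antisymm hxu ?_
    have := mpn_le_of_left (x := fun t => - x t) (b := -u) (by fun_prop) ht1'
      (fun t' h1 h2 => by have := hgt t' h1 h2; linarith)
    linarith
  have htd : deriv x t ≤ 0 := by
    have := mpn_deriv_nonneg (x := fun t => - x t) (by fun_prop) ht1'
      (fun t' h1 h2 => by have := hgt t' h1 h2; linarith)
    rw [deriv.fun_neg] at this
    linarith
  have hteq : t - r u = σ - r b₁ := by
    refine le_antisymm hts ?_
    by_contra! h3
    have e1 : ∀ᶠ t' in nhds t, x t' < b₁ :=
      hxc.continuousAt.eventually_lt continuousAt_const (by rwa [hxt])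
    have e2 : ∀ᶠ t' in nhds t, t' - r (x t') < σ - r b₁ :=
      ContinuousAt.eventually_lt (f := fun t' => t' - r (x t'))
        (by fun_prop) continuousAt_const (by rwa [hxt])
    have e3 : ∀ᶠ t' in nhdsWithin t (Set.Iio t), t' ∈ Set.Ioo t₁ t := Ioo_mem_nhdsLT ht1'
    have e4 := (e1.and e2).filter_mono (nhdsWithin_le_nhds (s := Set.Iio t))
    obtain ⟨t', ⟨h4, h5⟩, h6, h7⟩ := (e4.and e3).exists
    have h8 := hgt t' h6 h7
    have := hmin' t' (x t') ⟨⟨⟨h6.le, by dsimp; linarith⟩, ⟨by dsimp; linarith, h4.le⟩⟩,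
      le_rfl, h5.le⟩
    linarith
  have h9 := hdde t
  rw [hxt, hteq] at h9
  have := mul_nonpos_of_nonneg_of_nonpos hε.le htd
  linarith

lemma mpn_weak (f r : ℝ → ℝ) (hr : Continuous r)
    (ε : ℝ) (hε : 0 < ε) (x : ℝ → ℝ) (hx : Differentiable ℝ x)
    (hdde : ∀ t : ℝ, ε * deriv x t = -x t + f (x (t - r (x t))))
    (b₀ b₁ : ℝ) (hb : b₀ < b₁) (t₀ t₁ t₂ : ℝ) (h01 : t₀ < t₁) (h12 : t₁ < t₂)
    (hx0 : x t₀ ≤ b₀) (hx1 : b₁ ≤ x t₁) (hx2 : x t₂ ≤ b₀) :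
    r b₀ - r b₁ ≤ t₂ - t₀ := by
  have := mpn_le_of_left (x := fun b => r b₀ - r b) (b := t₂ - t₀) (by fun_prop) hb
    (fun b h1 h2 => mpn_strict f r hr ε hε x hx hdde b₀ b h1 t₀ t₁ t₂ h01 h12 hx0
      (by linarith) hx2)
  exact this

/-- Mallet-Paret–Nussbaum oscillation bound: if a solution of the
state-dependent DDE `ε·x′(t) = −x(t) + f(x(t − r(x(t))))` alternately visits
levels `≤ a₀` and `≥ a₁` at times `t₀ < t₁ < t₂ < t₃`, then the oscillation of
the delay function `r` over `[a₀, a₁]` is at most `3·(t₃ − t₀)`. -/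
theorem mallet_paret_nussbaum_oscillation_bound
    (f r : ℝ → ℝ) (hf : Continuous f)
    (hr : ∃ K : NNReal, LipschitzWith K r) (hr0 : ∀ u : ℝ, 0 ≤ r u)
    (ε : ℝ) (hε : 0 < ε)
    (x : ℝ → ℝ) (hx : Differentiable ℝ x)
    (hdde : ∀ t : ℝ, ε * deriv x t = -x t + f (x (t - r (x t))))
    (a₀ a₁ : ℝ) (ha : a₀ < a₁)
    (t₀ t₁ t₂ t₃ : ℝ) (h01 : t₀ < t₁) (h12 : t₁ < t₂) (h23 : t₂ < t₃)
    (hx0 : x t₀ ≤ a₀) (hx1 : a₁ ≤ x t₁) (hx2 : x t₂ ≤ a₀) (hx3 : a₁ ≤ x t₃) :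
    sSup (r '' Set.Icc a₀ a₁) - sInf (r '' Set.Icc a₀ a₁) ≤ 3 * (t₃ - t₀) := by
  obtain ⟨K, hK⟩ := hr
  have hrc := hK.continuous
  have key : ∀ u ∈ Set.Icc a₀ a₁, ∀ v ∈ Set.Icc a₀ a₁, r u - r v ≤ 3 * (t₃ - t₀) := by
    rintro u ⟨hu0, hu1⟩ v ⟨hv0, hv1⟩
    rcases lt_trichotomy u v with h | h | h
    · have := mpn_weak f r hrc ε hε x hx hdde u v h t₀ t₁ t₂ h01 h12 (by linarith)
        (by linarith) (by linarith)
      linarith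
    · subst h
      linarith
    · have := mpn_weak (fun y => - f (-y)) (fun y => r (-y)) (by fun_prop) ε hε
        (fun t => - x t) (by fun_prop)
        (fun t => by
          rw [deriv.fun_neg]
          simp only [neg_neg]
          linarith [hdde t])
        (-u) (-v) (by linarith) t₁ t₂ t₃ h12 h23 (by linarith) (by linarith) (by linarith)
      simp only [neg_neg] at this
      linarith
  have hne : (r '' Set.Icc a₀ a₁).Nonempty := ⟨r a₀, a₀, ⟨le_rfl, ha.le⟩, rfl⟩
  rw [sub_le_iff_le_add]
  refine csSup_le hne ?_
  rintro _ ⟨u, hu, rfl⟩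
  rw [← sub_le_iff_le_add']
  refine le_csInf hne ?_
  rintro _ ⟨v, hv, rfl⟩
  linarith [key u hu v hv]
end

section
/- Let f : ℝ → ℝ be continuous, let R : ℝ → ℝ be Lipschitz continuous, let η₀ > 0 with 1 + η₀·R(u) ≥ 0 for all u ∈ ℝ, and let ε > 0. Let x : ℝ → ℝ be a nonconstant differentiable T-periodic solution (T > 0) of ε·x′(t) = −x(t) + f(x(t − 1 − η₀·R(x(t)))) for all t ∈ ℝ, and set a₀ := min_{t∈ℝ} x(t) and a₁ := max_{t∈ℝ} x(t). Then η₀·( sup_{u ∈ [a₀,a₁]} R(u) − inf_{u ∈ [a₀,a₁]} R(u) ) ≤ 6·T. -/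
/-- An antitone function crosses a continuous one lying above it on the left, below on the right. -/
lemma crossing_aux (s ρ : ℝ → ℝ) (u₁ u₂ : ℝ) (h12 : u₁ ≤ u₂)
    (hs : ∀ a b, u₁ ≤ a → a ≤ b → b ≤ u₂ → s b ≤ s a) (hρ : Continuous ρ)
    (h1 : s u₁ ≤ ρ u₁) (h2 : ρ u₂ < s u₂) :
    ∃ u, u₁ ≤ u ∧ u < u₂ ∧ s u = ρ u := by
  set S : Set ℝ := {u | u₁ ≤ u ∧ u ≤ u₂ ∧ s u ≤ ρ u} with hS
  have hne : S.Nonempty := ⟨u₁, le_refl _, h12, h1⟩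
  have hbdd : BddAbove S := ⟨u₂, fun u hu => hu.2.1⟩
  have hlub := isLUB_csSup hne hbdd
  set w := sSup S
  have hw1 : u₁ ≤ w := hlub.1 ⟨le_refl _, h12, h1⟩
  have hw2 : w ≤ u₂ := hlub.2 fun u hu => hu.2.1
  have hle : s w ≤ ρ w := by
    have hcl : w ∈ closure S := csSup_mem_closure hne hbdd
    have hsub : S ⊆ {u | s w ≤ ρ u} := by
      intro u hu
      exact (hs u w hu.1 (hlub.1 hu) hw2).trans hu.2.2
    have hclosed : IsClosed {u | s w ≤ ρ u} := isClosed_le continuous_const hρ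
    exact closure_minimal hsub hclosed hcl
  have hlt : w < u₂ := by
    rcases hw2.lt_or_eq with h | h
    · exact h
    · rw [h] at hle; linarith
  refine ⟨w, hw1, hlt, le_antisymm hle ?_⟩
  have hcl : w ∈ closure (Set.Ioo w u₂) := by
    rw [closure_Ioo hlt.ne]; exact ⟨le_refl _, hlt.le⟩
  have hsub : Set.Ioo w u₂ ⊆ {u | ρ u ≤ s w} := by
    intro u hu
    have hnot : ¬ s u ≤ ρ u := fun h =>
      absurd (hlub.1 (show u ∈ S from ⟨hw1.trans hu.1.le, hu.2.le, h⟩)) (not_le.2 hu.1)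
    exact (not_le.1 hnot).le.trans (hs w u hw1 hu.1.le hu.2.le)
  exact closure_minimal hsub (isClosed_le hρ continuous_const) hcl

lemma decreasing_case
    (f R : ℝ → ℝ) (hRc : Continuous R) (η₀ ε T : ℝ) (hε : 0 < ε) (hT : 0 < T)
    (x : ℝ → ℝ) (hx : Differentiable ℝ x)
    (hper : ∀ t : ℝ, x (t + T) = x t)
    (hdde : ∀ t : ℝ, ε * deriv x t = -x t + f (x (t - 1 - η₀ * R (x t))))
    (a₀ a₁ : ℝ)
    (ha₀ : IsLeast (Set.range x) a₀) (ha₁ : IsGreatest (Set.range x) a₁)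
    (u₁ u₂ : ℝ) (h1 : a₀ ≤ u₁) (h12 : u₁ < u₂) (h2 : u₂ ≤ a₁) :
    η₀ * (R u₁ - R u₂) ≤ 6 * T := by
  by_contra! hcon
  obtain ⟨⟨c, hc⟩, hmax⟩ := ha₁
  obtain ⟨⟨d₀, hd₀⟩, hmin⟩ := ha₀
  have hP : Function.Periodic x T := hper
  obtain ⟨d, hdI, hd⟩ := hP.exists_mem_Ico hT d₀ c
  rw [hd₀] at hd
  replace hd := hd.symm
  have hcd : c ≤ d := hdI.1
  have hdT : d < c + T := hdI.2
  -- the value a₁ is attained by f ∘ x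
  have hcder : deriv x c = 0 := by
    apply IsLocalMax.deriv_eq_zero
    exact Filter.Eventually.of_forall fun t => by rw [hc]; exact hmax ⟨t, rfl⟩
  have hq := hdde c
  rw [hcder, hc] at hq
  set q := c - 1 - η₀ * R a₁
  have hgq : f (x q) = a₁ := by linarith
  -- last time at which x ≥ u
  set A : ℝ → Set ℝ := fun u => Set.Icc c d ∩ {t | u ≤ x t} with hA
  have hAc : ∀ u, IsCompact (A u) := fun u =>
    isCompact_Icc.inter_right (isClosed_le continuous_const hx.continuous)
  have hAne : ∀ u, u ≤ a₁ → (A u).Nonempty := fun u hu =>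
    ⟨c, ⟨le_refl _, hcd⟩, by simpa [hc] using hu⟩
  set s : ℝ → ℝ := fun u => sSup (A u) with hs
  have hsmem : ∀ u, u ≤ a₁ → s u ∈ A u := fun u hu => (hAc u).sSup_mem (hAne u hu)
  have hsle : ∀ u t, t ∈ A u → t ≤ s u := fun u t ht => le_csSup (hAc u).bddAbove ht
  have hanti : ∀ a b, u₁ ≤ a → a ≤ b → b ≤ u₂ → s b ≤ s a := by
    intro a b _ hab hb
    have := hsmem b (hb.trans h2)
    exact hsle a _ ⟨this.1, hab.trans this.2⟩
  have hxs : ∀ u, a₀ ≤ u → u ≤ a₁ → x (s u) = u := by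
    intro u hu0 hu1
    have hm := hsmem u hu1
    have hivt := intermediate_value_Icc' hm.1.2 (hx.continuous.continuousOn (s := Set.Icc (s u) d))
    obtain ⟨t, ht, hxt⟩ := hivt ⟨by rw [hd]; exact hu0, hm.2⟩
    have : t ≤ s u := hsle u t ⟨⟨hm.1.1.trans ht.1, ht.2⟩, hxt.ge⟩
    have : t = s u := le_antisymm this ht.1
    rw [← this]; exact hxt
  have hder : ∀ u, a₀ ≤ u → u ≤ a₁ → deriv x (s u) ≤ 0 := by
    intro u hu0 hu1
    have hm := hsmem u hu1
    have hxu := hxs u hu0 hu1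
    rcases hu0.eq_or_lt with h | h
    · apply le_of_eq
      apply IsLocalMin.deriv_eq_zero
      exact Filter.Eventually.of_forall fun t => by rw [hxu, ← h]; exact hmin ⟨t, rfl⟩
    · have hsd : s u < d := by
        rcases hm.1.2.lt_or_eq with h' | h'
        · exact h'
        · rw [h', hd] at hxu; linarith
      have hD := ((hx (s u)).hasDerivAt.hasDerivWithinAt (s := Set.Ioi (s u)))
      rw [hasDerivWithinAt_iff_tendsto_slope' (by simp)] at hD
      refine le_of_tendsto hD ?_
      filter_upwards [Ioo_mem_nhdsGT hsd] with t ht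
      have hlt : x t < u := by
        by_contra! hge
        exact absurd (hsle u t ⟨⟨hm.1.1.trans ht.1.le, ht.2.le⟩, hge⟩) (not_le.2 ht.1)
      rw [slope_def_field, hxu]
      exact div_nonpos_of_nonpos_of_nonneg (by linarith) (by linarith [ht.1])
  -- choose the phase
  have hm1 := (hsmem u₁ (h12.le.trans h2)).1
  have hm2 := (hsmem u₂ h2).1
  set B := s u₁ - 1 - η₀ * R u₁ with hB
  set k : ℤ := ⌈(B - q) / T⌉ with hk
  have hk1 : B ≤ q + k * T := by
    have := Int.le_ceil ((B - q) / T)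
    rw [div_le_iff₀ hT] at this
    linarith
  have hk2 : q + k * T < B + T := by
    have := Int.ceil_lt_add_one ((B - q) / T)
    rw [← hk] at this
    have h3 : (k : ℝ) - 1 < (B - q) / T := by linarith
    rw [lt_div_iff₀ hT] at h3
    linarith
  obtain ⟨u, hu1, hu2, hu⟩ := crossing_aux s (fun u => (q + k * T) + 1 + η₀ * R u) u₁ u₂ h12.le
    hanti (by fun_prop) (by linarith)
    (by linarith [hm1.1, hm1.2, hm2.1, hm2.2])
  have hua0 : a₀ ≤ u := h1.trans hu1
  have hua1 : u < a₁ := hu2.trans_le h2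
  have e := hdde (s u)
  rw [hxs u hua0 hua1.le, hu] at e
  have e2 : (q + k * T) + 1 + η₀ * R u - 1 - η₀ * R u = q + k * T := by ring
  have e3 : x (q + k * T) = x q := hP.int_mul k q
  simp only [e2, e3, hgq] at e
  have e4 := hder u hua0 hua1.le
  rw [hu] at e4
  nlinarith

/-- Amplitude–period estimate (Proposition 2): for a nonconstant `T`-periodic
solution of `ε·x′(t) = −x(t) + f(x(t − 1 − η₀·R(x(t))))`, with `a₀ = min x` and
`a₁ = max x`, the oscillation of `R` over `[a₀, a₁]` weighted by `η₀` is at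
most `6·T`. -/
theorem amplitude_period_estimate
    (f R : ℝ → ℝ) (hf : Continuous f)
    (hR : ∃ K : NNReal, LipschitzWith K R)
    (η₀ : ℝ) (hη₀ : 0 < η₀) (hdelay : ∀ u : ℝ, 0 ≤ 1 + η₀ * R u)
    (ε : ℝ) (hε : 0 < ε)
    (T : ℝ) (hT : 0 < T)
    (x : ℝ → ℝ) (hx : Differentiable ℝ x)
    (hnonconst : ∃ t s : ℝ, x t ≠ x s)
    (hper : ∀ t : ℝ, x (t + T) = x t)
    (hdde : ∀ t : ℝ, ε * deriv x t = -x t + f (x (t - 1 - η₀ * R (x t))))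
    (a₀ a₁ : ℝ)
    (ha₀ : IsLeast (Set.range x) a₀) (ha₁ : IsGreatest (Set.range x) a₁) :
    η₀ * (sSup (R '' Set.Icc a₀ a₁) - sInf (R '' Set.Icc a₀ a₁)) ≤ 6 * T := by
  obtain ⟨K, hK⟩ := hR
  have hRc : Continuous R := hK.continuous
  have h01 : a₀ ≤ a₁ := ha₀.2 ha₁.1
  have hcomp : IsCompact (R '' Set.Icc a₀ a₁) := isCompact_Icc.image hRc
  have hne : (R '' Set.Icc a₀ a₁).Nonempty := (Set.nonempty_Icc.2 h01).image R
  obtain ⟨u, hu, hRu⟩ := hcomp.sSup_mem hne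
  obtain ⟨v, hv, hRv⟩ := hcomp.sInf_mem hne
  rw [← hRu, ← hRv]
  rcases lt_trichotomy u v with h | h | h
  · exact decreasing_case f R hRc η₀ ε T hε hT x hx hper hdde a₀ a₁ ha₀ ha₁ u v hu.1 h hv.2
  · rw [h]; linarith
  · have key := decreasing_case (fun w => -f (-w)) (fun w => R (-w)) (by fun_prop) η₀ ε T hε hT
      (fun t => -x t) hx.neg (fun t => by simp [hper t])
      (fun t => by
        have := hdde t
        have hd : deriv (fun t => -x t) t = - deriv x t := deriv.fun_neg
        rw [hd]
        simp only [neg_neg]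
        linarith)
      (-a₁) (-a₀)
      ⟨by obtain ⟨t, ht⟩ := ha₁.1; exact ⟨t, by simp [ht]⟩,
        by rintro _ ⟨t, rfl⟩; exact neg_le_neg (ha₁.2 ⟨t, rfl⟩)⟩
      ⟨by obtain ⟨t, ht⟩ := ha₀.1; exact ⟨t, by simp [ht]⟩,
        by rintro _ ⟨t, rfl⟩; exact neg_le_neg (ha₀.2 ⟨t, rfl⟩)⟩
      (-u) (-v) (neg_le_neg hu.2) (neg_lt_neg h) (neg_le_neg hv.1)
    simpa using key
end

section
/- Let f : ℝ → ℝ be continuous, let R : ℝ → ℝ be continuous and strictly monotone, let η₀ > 0 and M > 0 with 1 + η₀·R(u) ≥ 0 for all u ∈ [−M, M]. For each k, let xₖ : ℝ → ℝ be a differentiable Tₖ-periodic solution (Tₖ > 0) of εₖ·xₖ′(t) = −xₖ(t) + f(xₖ(t − 1 − η₀·R(xₖ(t)))) for some εₖ > 0, with |xₖ(t)| ≤ M for all t. If Tₖ → 0 as k → ∞, then the amplitudes max_{t} xₖ(t) − min_{t} xₖ(t) converge to 0 as k → ∞. -/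
open Filter

/-- For increasing `R`, the oscillation of `R ∘ x` above the minimum is at most `2T/η₀`. -/
lemma osc_bound (f R : ℝ → ℝ) (hRc : Continuous R) (hR : StrictMono R)
    (η T ε : ℝ) (hη : 0 < η) (hT : 0 < T) (hε : 0 < ε) (x : ℝ → ℝ)
    (hx : Differentiable ℝ x) (hper : ∀ t, x (t + T) = x t)
    (hdde : ∀ t, ε * deriv x t = -x t + f (x (t - 1 - η * R (x t)))) (s r : ℝ) :
    η * (R (x s) - R (x r)) ≤ 2 * T := by
  have hxc : Continuous x := hx.continuous
  have hP : Function.Periodic x T := hper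
  -- a global minimum
  obtain ⟨t0, -, ht0⟩ := (isCompact_Icc (a := (0:ℝ)) (b := T)).exists_isMinOn
    ⟨0, Set.left_mem_Icc.2 hT.le⟩ hxc.continuousOn
  have hmin : ∀ t, x t0 ≤ x t := by
    intro t
    obtain ⟨y, hy, hxy⟩ := hP.exists_mem_Ico₀ hT t
    rw [hxy]
    exact ht0 ⟨hy.1, hy.2.le⟩
  have hr : R (x t0) ≤ R (x r) := hR.monotone (hmin r)
  suffices h : η * (R (x s) - R (x t0)) ≤ 2 * T by nlinarith
  obtain ⟨t1, ht1, hs1⟩ := hP.exists_mem_Ico hT s t0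
  rw [hs1]
  by_contra! hcon
  set φ : ℝ → ℝ := fun t => t - 1 - η * R (x t) with hφ
  have hφc : Continuous φ := by fun_prop
  set c := φ t0 - T with hc
  have hd0 : deriv x t0 = 0 := by
    apply IsLocalMin.deriv_eq_zero
    exact Filter.Eventually.of_forall hmin
  have hfc : f (x c) = x t0 := by
    have h1 : x c = x (φ t0) := hP.sub_eq (φ t0)
    have h2 := hdde t0
    rw [hd0] at h2
    rw [h1]
    simp only [hφ]
    linarith
  have hφ1 : φ t1 ≤ c := by
    have := ht1.2
    simp only [hc, hφ]
    nlinarith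
  have hφ0 : c < φ t0 := by linarith
  obtain ⟨a, ha, hac⟩ := intermediate_value_Icc' ht1.1 hφc.continuousOn
    (show c ∈ Set.Icc (φ t1) (φ t0) from ⟨hφ1, hφ0.le⟩)
  have hcomp : IsCompact (Set.Icc t0 t1 ∩ φ ⁻¹' {c}) :=
    isCompact_Icc.inter_right (isClosed_singleton.preimage hφc)
  obtain ⟨τ, ⟨hτ, hτc⟩, hleast⟩ := hcomp.exists_isLeast ⟨a, ha, hac⟩
  have hτc : φ τ = c := hτc
  have hlt : t0 < τ := by
    rcases hτ.1.lt_or_eq with h | h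
    · exact h
    · rw [← h] at hτc
      linarith
  have hbefore : ∀ t ∈ Set.Ioo t0 τ, c < φ t := by
    intro t ht
    by_contra! h
    obtain ⟨b, hb, hbc⟩ := intermediate_value_Icc' ht.1.le hφc.continuousOn
      (show c ∈ Set.Icc (φ t) (φ t0) from ⟨h, hφ0.le⟩)
    have := hleast ⟨⟨hb.1, by linarith [hb.2, ht.2, hτ.2]⟩, hbc⟩
    linarith [hb.2, ht.2]
  have hxτ : x t0 < x τ := by
    rcases (hmin τ).lt_or_eq with h | h
    · exact h
    · exfalso
      have h3 : φ τ = τ - 1 - η * R (x τ) := rfl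
      have h4 : φ t0 = t0 - 1 - η * R (x t0) := rfl
      rw [← h] at h3
      linarith
  have hdτ : deriv x τ < 0 := by
    have h2 := hdde τ
    have h3 : τ - 1 - η * R (x τ) = c := hτc
    rw [h3, hfc] at h2
    by_contra! h
    have := mul_nonneg hε.le h
    linarith
  have hslope := hasDerivAt_iff_tendsto_slope.1 (hx τ).hasDerivAt
  have hev := (hslope.mono_left (nhdsWithin_mono τ
    (show Set.Iio τ ⊆ {τ}ᶜ from fun y hy => ne_of_lt hy))).eventually (gt_mem_nhds hdτ)
  have hev2 : ∀ᶠ t in nhdsWithin τ (Set.Iio τ), t ∈ Set.Ioo t0 τ := Ioo_mem_nhdsLT hlt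
  obtain ⟨t, ht, htm⟩ := (hev.and hev2).exists
  have hxt : x τ < x t := by
    rw [slope_def_field] at ht
    by_contra! h
    have : 0 ≤ (x t - x τ) / (t - τ) :=
      div_nonneg_of_nonpos (by linarith) (by linarith [htm.2])
    linarith
  have h5 := hbefore t htm
  have h6 : R (x τ) < R (x t) := hR hxt
  have h3 : φ τ = τ - 1 - η * R (x τ) := rfl
  have h4 : φ t = t - 1 - η * R (x t) := rfl
  have := mul_lt_mul_of_pos_left h6 hη
  linarith [htm.2]

lemma osc_small (f R : ℝ → ℝ) (hRc : Continuous R) (hR : StrictMono R)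
    (η M : ℝ) (hη : 0 < η)
    (x : ℕ → ℝ → ℝ) (T ε : ℕ → ℝ)
    (hT : ∀ k, 0 < T k) (hε : ∀ k, 0 < ε k)
    (hx : ∀ k, Differentiable ℝ (x k))
    (hper : ∀ k, ∀ t : ℝ, x k (t + T k) = x k t)
    (hdde : ∀ k, ∀ t : ℝ,
      ε k * deriv (x k) t = -x k t + f (x k (t - 1 - η * R (x k t))))
    (hbound : ∀ k, ∀ t : ℝ, |x k t| ≤ M)
    (hT0 : Tendsto T atTop (nhds 0)) (δ : ℝ) (hδ : 0 < δ) :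
    ∀ᶠ k in atTop, ∀ s r, x k s - x k r ≤ δ := by
  have hM : 0 ≤ M := (abs_nonneg _).trans (hbound 0 0)
  obtain ⟨u, -, hu⟩ := (isCompact_Icc (a := -M) (b := M)).exists_isMinOn
    ⟨M, by constructor <;> linarith⟩
    (show ContinuousOn (fun v => R (v + δ) - R v) (Set.Icc (-M) M) by fun_prop)
  have hκ : 0 < R (u + δ) - R u := sub_pos.2 (hR (by linarith))
  have hκ' : 0 < η * (R (u + δ) - R u) / 2 := by positivity
  filter_upwards [hT0.eventually (gt_mem_nhds hκ')] with k hk s r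
  by_contra! h
  have h1 := osc_bound f R hRc hR η (T k) (ε k) hη (hT k) (hε k) (x k) (hx k) (hper k)
    (hdde k) s r
  have h2 : R (u + δ) - R u ≤ R (x k r + δ) - R (x k r) := hu (abs_le.1 (hbound k r))
  have h3 : R (x k r + δ) ≤ R (x k s) := hR.monotone (by linarith)
  have h4 := mul_le_mul_of_nonneg_left
    (show R (u + δ) - R u ≤ R (x k s) - R (x k r) by linarith) hη.le
  linarith

/-- Second conclusion of Proposition 2: for a uniformly bounded family of
periodic solutions of `εₖ·x′(t) = −x(t) + f(x(t − 1 − η₀·R(x(t))))` with a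
strictly monotone `R` and periods `Tₖ → 0`, the amplitudes
`max xₖ − min xₖ` tend to `0`. -/
theorem small_period_implies_small_amplitude
    (f R : ℝ → ℝ) (hf : Continuous f) (hRc : Continuous R)
    (hRmono : StrictMono R ∨ StrictAnti R)
    (η₀ M : ℝ) (hη₀ : 0 < η₀) (hM : 0 < M)
    (hdelay : ∀ u ∈ Set.Icc (-M) M, 0 ≤ 1 + η₀ * R u)
    (x : ℕ → ℝ → ℝ) (T : ℕ → ℝ) (ε : ℕ → ℝ)
    (hT : ∀ k, 0 < T k) (hε : ∀ k, 0 < ε k)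
    (hx : ∀ k, Differentiable ℝ (x k))
    (hper : ∀ k, ∀ t : ℝ, x k (t + T k) = x k t)
    (hdde : ∀ k, ∀ t : ℝ,
      ε k * deriv (x k) t = -x k t + f (x k (t - 1 - η₀ * R (x k t))))
    (hbound : ∀ k, ∀ t : ℝ, |x k t| ≤ M)
    (hTto0 : Tendsto T atTop (nhds 0)) :
    Tendsto (fun k => sSup (Set.range (x k)) - sInf (Set.range (x k)))
      atTop (nhds 0) := by
  have key : ∀ δ : ℝ, 0 < δ → ∀ᶠ k in atTop, ∀ s r, x k s - x k r ≤ δ := by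
    intro δ hδ
    rcases hRmono with hR | hR
    · exact osc_small f R hRc hR η₀ M hη₀ x T ε hT hε hx hper hdde hbound hTto0 δ hδ
    · have := osc_small (fun u => -f (-u)) (fun u => R (-u)) (by fun_prop)
        (fun a b hab => hR (neg_lt_neg hab)) η₀ M hη₀ (fun k t => -x k t) T ε hT hε
        (fun k => (hx k).neg) (fun k t => by simp only [hper])
        (fun k t => by
          have h := hdde k t
          have h2 : deriv (fun t => -x k t) t = -deriv (x k) t := deriv.fun_neg
          rw [h2]
          simp only [neg_neg]
          linarith)
        (fun k t => by rw [abs_neg]; exact hbound k t) hTto0 δ hδ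
      filter_upwards [this] with k hk s r
      have := hk r s
      linarith
  rw [Metric.tendsto_nhds]
  intro e he
  filter_upwards [key (e / 2) (by linarith)] with k hk
  have hne : (Set.range (x k)).Nonempty := Set.range_nonempty _
  have hba : BddAbove (Set.range (x k)) :=
    ⟨M, by rintro _ ⟨t, rfl⟩; exact (abs_le.1 (hbound k t)).2⟩
  have hbb : BddBelow (Set.range (x k)) :=
    ⟨-M, by rintro _ ⟨t, rfl⟩; exact (abs_le.1 (hbound k t)).1⟩
  have h0 : sInf (Set.range (x k)) ≤ sSup (Set.range (x k)) := (csInf_le hbb ⟨0, rfl⟩).trans (le_csSup hba ⟨0, rfl⟩)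
  have h1 : sSup (Set.range (x k)) ≤ sInf (Set.range (x k)) + e / 2 := by
    apply csSup_le hne
    rintro _ ⟨s, rfl⟩
    have : x k s - e / 2 ≤ sInf (Set.range (x k)) := by
      apply le_csInf hne
      rintro _ ⟨r, rfl⟩
      linarith [hk s r]
    linarith
  rw [Real.dist_eq, sub_zero, abs_of_nonneg (by linarith)]
  linarith
end

section
/- Let μ ∈ ℝ with |μ| > 1. Then there exist a strictly decreasing sequence (ε_k) of positive reals with ε_k → 0 and a strictly increasing sequence (β_k) of positive reals with β_k → +∞ such that for every k the complex number λ = i·β_k satisfies the characteristic equation 1 + ε_k·λ = μ·exp(−λ); moreover ε_k·β_k = √(μ² − 1) for every k. -/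
open Filter Complex

/-- Existence of the sequence of Hopf bifurcation points: for `|μ| > 1` there
are a strictly decreasing sequence `εₖ → 0` of positive reals and a strictly
increasing sequence `βₖ → +∞` of positive reals such that `λ = i·βₖ` solves
the characteristic equation `1 + εₖ·λ = μ·e^{−λ}`, and `εₖ·βₖ = √(μ² − 1)`. -/
theorem hopf_bifurcation_sequence (μ : ℝ) (hμ : 1 < |μ|) :
    ∃ ε β : ℕ → ℝ,
      StrictAnti ε ∧ (∀ k, 0 < ε k) ∧ Tendsto ε atTop (nhds 0) ∧
      StrictMono β ∧ (∀ k, 0 < β k) ∧ Tendsto β atTop atTop ∧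
      (∀ k, (1 : ℂ) + (ε k : ℂ) * (Complex.I * (β k : ℂ)) =
          (μ : ℂ) * Complex.exp (-(Complex.I * (β k : ℂ)))) ∧
      (∀ k, ε k * β k = Real.sqrt (μ ^ 2 - 1)) := by
  have hμ2 : 1 < μ ^ 2 := by
    rw [← sq_abs]; nlinarith
  have hμ0 : μ ≠ 0 := by
    rintro rfl; norm_num at hμ2
  have hμc : (μ : ℂ) ≠ 0 := by exact_mod_cast hμ0
  obtain ⟨s, hs⟩ : ∃ s, s = Real.sqrt (μ ^ 2 - 1) := ⟨_, rfl⟩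
  have hs0 : 0 < s := by rw [hs]; exact Real.sqrt_pos.mpr (by linarith)
  have hs2 : s ^ 2 = μ ^ 2 - 1 := by rw [hs]; exact Real.sq_sqrt (by linarith)
  obtain ⟨z, hz⟩ : ∃ z : ℂ, z = (1 + s * Complex.I) / μ := ⟨_, rfl⟩
  have hnum : ‖(1 + s * Complex.I : ℂ)‖ = |μ| := by
    have h := Complex.norm_add_mul_I 1 s
    rw [Complex.ofReal_one] at h
    rw [h, hs2, ← Real.sqrt_sq_eq_abs]
    congr 1; ring
  have hz1 : ‖z‖ = 1 := by
    rw [hz, norm_div, hnum, Complex.norm_real, Real.norm_eq_abs]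
    exact div_self (abs_ne_zero.mpr hμ0)
  have hzexp : Complex.exp (z.arg * Complex.I) = z := by
    have h := Complex.norm_mul_exp_arg_mul_I z
    rwa [hz1, Complex.ofReal_one, one_mul] at h
  have hpi := Real.pi_pos
  have harg := Complex.arg_le_pi z
  obtain ⟨β, hβ⟩ : ∃ β : ℕ → ℝ, ∀ k, β k = (k : ℝ) * (2 * Real.pi) + (2 * Real.pi - z.arg) :=
    ⟨_, fun _ => rfl⟩
  have hβpos : ∀ k, 0 < β k := by
    intro k
    rw [hβ]
    have : 0 ≤ (k : ℝ) * (2 * Real.pi) := by positivity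
    linarith
  have hβmono : StrictMono β := by
    apply strictMono_nat_of_lt_succ
    intro k
    rw [hβ, hβ]
    push_cast
    linarith
  have hβtop : Tendsto β atTop atTop := by
    rw [funext hβ]
    exact tendsto_atTop_add_const_right _ _
      (tendsto_natCast_atTop_atTop.atTop_mul_const (by positivity))
  have hprod : ∀ k, s / β k * β k = s := fun k => div_mul_cancel₀ _ (hβpos k).ne'
  refine ⟨fun k => s / β k, β, ?_, fun k => div_pos hs0 (hβpos k), hβtop.const_div_atTop s,
    hβmono, hβpos, hβtop, ?_, fun k => by rw [← hs]; exact hprod k⟩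
  · intro a b hab
    exact div_lt_div_of_pos_left hs0 (hβpos a) (hβmono hab)
  · intro k
    have h1 : ((s / β k : ℝ) : ℂ) * (Complex.I * (β k : ℂ)) = s * Complex.I := by
      have h : ((s / β k : ℝ) : ℂ) * (β k : ℂ) = s := by exact_mod_cast hprod k
      rw [← h]; ring
    have h2 : Complex.exp (-(Complex.I * (β k : ℂ))) = z := by
      have h : -(Complex.I * (β k : ℂ))
          = z.arg * Complex.I - ((k + 1 : ℕ) : ℂ) * (2 * Real.pi * Complex.I) := by
        rw [hβ]; push_cast; ring
      rw [h, Complex.exp_sub, Complex.exp_nat_mul_two_pi_mul_I, div_one, hzexp]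
    rw [h1, h2, hz, mul_div_cancel₀ _ hμc]
end

section
/- Let g : ℝ → ℝ be bounded and continuous and set ψ(t) := ∫_{−∞}^{t} e^{s−t}·g(s) ds. If χ : ℝ → ℝ is differentiable with χ′(t) = −χ(t) + g(t) for all t ∈ ℝ, and χ(t) converges to a finite limit as t → −∞, then χ(t) = ψ(t) for all t ∈ ℝ. -/
open MeasureTheory Filter

/-- Uniqueness: any solution `χ` of `χ′ = −χ + g` on `ℝ` having a finite limit
as `t → −∞` coincides with `ψ(t) = ∫_{−∞}^{t} e^{s−t}·g(s) ds`. -/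
theorem variation_of_constants_unique
    (g : ℝ → ℝ) (hg : Continuous g) (hgb : ∃ C : ℝ, ∀ s : ℝ, |g s| ≤ C)
    (χ : ℝ → ℝ) (hχ : Differentiable ℝ χ)
    (hode : ∀ t : ℝ, deriv χ t = -χ t + g t)
    (hlim : ∃ L : ℝ, Tendsto χ atBot (nhds L)) :
    ∀ t : ℝ, χ t = ∫ s in Set.Iic t, Real.exp (s - t) * g s := by
  intro t
  obtain ⟨C, hC⟩ := hgb
  obtain ⟨L, hL⟩ := hlim
  have hexp : IntegrableOn (fun s : ℝ => Real.exp (s - t)) (Set.Iic t) := by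
    have h := (integrableOn_exp_Iic t).mul_const (Real.exp (-t))
    refine h.congr (Eventually.of_forall fun s => ?_)
    simp only [← Real.exp_add, sub_eq_add_neg]
  have hint : IntegrableOn (fun s : ℝ => Real.exp (s - t) * g s) (Set.Iic t) := by
    refine Integrable.mul_bdd (c := C) hexp hg.aestronglyMeasurable ?_
    exact Eventually.of_forall fun s => by simpa using hC s
  have hderiv : ∀ x ∈ Set.Iic t,
      HasDerivAt (fun s => Real.exp (s - t) * χ s) (Real.exp (x - t) * g x) x := by
    intro x _
    have h1 : HasDerivAt (fun s : ℝ => Real.exp (s - t)) (Real.exp (x - t) * 1) x :=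
      ((hasDerivAt_id x).sub_const t).exp
    have h2 := (hχ x).hasDerivAt
    rw [hode x] at h2
    refine (h1.mul h2).congr_deriv ?_
    ring
  have htend : Tendsto (fun s => Real.exp (s - t) * χ s) atBot (nhds 0) := by
    have h1 : Tendsto (fun s : ℝ => Real.exp (s - t)) atBot (nhds 0) :=
      Real.tendsto_exp_atBot.comp (tendsto_atBot_add_const_right _ (-t) tendsto_id)
    simpa using h1.mul hL
  rw [integral_Iic_of_hasDerivAt_of_tendsto' hderiv hint htend]
  simp
end

section
/- Let a, b > 0, let f : ℝ → ℝ be continuous and strictly increasing on the interval [−a, b], let φ : ℝ → ℝ be continuous, strictly increasing, with φ(t) ∈ (−a, b) for all t, and let R : ℝ → ℝ be continuous. For γ ∈ ℝ define Ψ(γ) := ∫_{−∞}^{0} e^{s}·f(φ(s + γ − R(φ(s)))) ds. Then Ψ is strictly increasing: if γ₁ < γ₂ then Ψ(γ₁) < Ψ(γ₂). -/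
open MeasureTheory

/-- Strict monotonicity of the normalization integral: for an increasing
feedback `f` on `[−a, b]`, an increasing profile `φ` with values in `(−a, b)`
and a continuous `R`, the map
`γ ↦ ∫_{−∞}^{0} e^{s}·f(φ(s + γ − R(φ(s)))) ds` is strictly increasing. -/
theorem normalization_integral_strictMono
    (a b : ℝ) (ha : 0 < a) (hb : 0 < b)
    (f : ℝ → ℝ) (hf : Continuous f) (hfmono : StrictMonoOn f (Set.Icc (-a) b))
    (φ : ℝ → ℝ) (hφc : Continuous φ) (hφmono : StrictMono φ)
    (hφrange : ∀ t : ℝ, φ t ∈ Set.Ioo (-a) b)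
    (R : ℝ → ℝ) (hR : Continuous R)
    (γ₁ γ₂ : ℝ) (hγ : γ₁ < γ₂) :
    (∫ s in Set.Iic (0 : ℝ), Real.exp s * f (φ (s + γ₁ - R (φ s)))) <
      ∫ s in Set.Iic (0 : ℝ), Real.exp s * f (φ (s + γ₂ - R (φ s))) := by
  have hmem : ∀ t, φ t ∈ Set.Icc (-a) b := fun t => Set.Ioo_subset_Icc_self (hφrange t)
  have hab : -a ≤ b := by linarith
  have hint : ∀ γ : ℝ, Integrable (fun s => Real.exp s * f (φ (s + γ - R (φ s))))
      (volume.restrict (Set.Iic (0 : ℝ))) := by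
    intro γ
    have hc : Continuous (fun s => f (φ (s + γ - R (φ s)))) := by fun_prop
    refine Integrable.mul_bdd (c := max |f (-a)| |f b|) (integrableOn_exp_Iic 0)
      hc.aestronglyMeasurable (Filter.Eventually.of_forall fun s => ?_)
    have h := hmem (s + γ - R (φ s))
    have h1 := hfmono.monotoneOn (Set.left_mem_Icc.2 hab) h h.1
    have h2 := hfmono.monotoneOn h (Set.right_mem_Icc.2 hab) h.2
    rw [Real.norm_eq_abs]
    exact abs_le_max_abs_abs h1 h2
  have hlt : ∀ s, Real.exp s * f (φ (s + γ₁ - R (φ s))) <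
      Real.exp s * f (φ (s + γ₂ - R (φ s))) := by
    intro s
    refine mul_lt_mul_of_pos_left ?_ (Real.exp_pos s)
    exact hfmono (hmem _) (hmem _) (hφmono (by linarith))
  rw [← sub_pos, ← integral_sub (hint γ₂) (hint γ₁),
    integral_pos_iff_support_of_nonneg (fun s => sub_nonneg.2 (hlt s).le)
      ((hint γ₂).sub (hint γ₁))]
  have hs : Function.support (fun s => Real.exp s * f (φ (s + γ₂ - R (φ s))) -
      Real.exp s * f (φ (s + γ₁ - R (φ s)))) = Set.univ :=
    Set.eq_univ_of_forall fun s => (sub_pos.2 (hlt s)).ne'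
  rw [hs]
  simp
end

section
/- Let a, b > 0, let f : ℝ → ℝ be continuous and strictly increasing on [−a, b] with f(−a) = −a and f(b) = b, let φ : ℝ → ℝ be continuous and strictly increasing with φ(t) → −a as t → −∞ and φ(t) → b as t → +∞ (so φ(t) ∈ (−a, b) for all t), and let R : ℝ → ℝ be continuous. Then there exists a unique ρ ∈ ℝ such that ∫_{−∞}^{0} e^{s}·f(φ(s + ρ − R(φ(s)))) ds = 0. -/
open MeasureTheory Filter

/-- Existence and uniqueness of the normalization constant `ρ` of the
transition layer operator: for a positive feedback `f` increasing on `[−a, b]`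
with `f(−a) = −a`, `f(b) = b`, and an increasing profile `φ` connecting `−a`
to `b`, there is a unique `ρ` with
`∫_{−∞}^{0} e^{s}·f(φ(s + ρ − R(φ(s)))) ds = 0`. -/
theorem normalization_constant_exists_unique
    (a b : ℝ) (ha : 0 < a) (hb : 0 < b)
    (f : ℝ → ℝ) (hf : Continuous f) (hfmono : StrictMonoOn f (Set.Icc (-a) b))
    (hfa : f (-a) = -a) (hfb : f b = b)
    (φ : ℝ → ℝ) (hφc : Continuous φ) (hφmono : StrictMono φ)
    (hφbot : Tendsto φ atBot (nhds (-a))) (hφtop : Tendsto φ atTop (nhds b))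
    (hφrange : ∀ t : ℝ, φ t ∈ Set.Ioo (-a) b)
    (R : ℝ → ℝ) (hR : Continuous R) :
    ∃! ρ : ℝ,
      (∫ s in Set.Iic (0 : ℝ), Real.exp s * f (φ (s + ρ - R (φ s)))) = 0 := by
  have hI : ∀ t, φ t ∈ Set.Icc (-a) b := fun t => Set.Ioo_subset_Icc_self (hφrange t)
  have hab : -a ≤ b := by linarith
  have hlo : ∀ t, -a ≤ f (φ t) := fun t => by
    have := hfmono.monotoneOn (Set.left_mem_Icc.2 hab) (hI t) (hI t).1
    linarith
  have hhi : ∀ t, f (φ t) ≤ b := fun t => by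
    have := hfmono.monotoneOn (hI t) (Set.right_mem_Icc.2 hab) (hI t).2
    linarith
  have hg : StrictMono (fun t => f (φ t)) := fun x y hxy => hfmono (hI x) (hI y) (hφmono hxy)
  have hexp : IntegrableOn Real.exp (Set.Iic (0 : ℝ)) := integrableOn_exp_Iic 0
  have hbint : Integrable (fun s => Real.exp s * (a + b)) (volume.restrict (Set.Iic (0 : ℝ))) :=
    hexp.mul_const _
  have hcont : ∀ γ : ℝ, Continuous (fun s => Real.exp s * f (φ (s + γ - R (φ s)))) := by
    intro γ
    fun_prop
  have hmeas : ∀ γ : ℝ, AEStronglyMeasurable (fun s => Real.exp s * f (φ (s + γ - R (φ s))))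
      (volume.restrict (Set.Iic (0 : ℝ))) := fun γ => (hcont γ).aestronglyMeasurable
  have hbd : ∀ γ s : ℝ, ‖Real.exp s * f (φ (s + γ - R (φ s)))‖ ≤ Real.exp s * (a + b) := by
    intro γ s
    rw [norm_mul, Real.norm_eq_abs, Real.norm_eq_abs, Real.abs_exp]
    refine mul_le_mul_of_nonneg_left ?_ (Real.exp_pos s).le
    rw [abs_le]
    constructor
    · linarith [hlo (s + γ - R (φ s))]
    · linarith [hhi (s + γ - R (φ s))]
  have hint : ∀ γ : ℝ, Integrable (fun s => Real.exp s * f (φ (s + γ - R (φ s))))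
      (volume.restrict (Set.Iic (0 : ℝ))) := fun γ =>
    hbint.mono' (hmeas γ) (Eventually.of_forall (hbd γ))
  set G : ℝ → ℝ := fun γ => ∫ s in Set.Iic (0 : ℝ), Real.exp s * f (φ (s + γ - R (φ s))) with hG
  have hGc : Continuous G := by
    refine continuous_of_dominated hmeas (fun γ => Eventually.of_forall (hbd γ)) hbint
      (Eventually.of_forall fun s => ?_)
    fun_prop
  have hval : ∀ c : ℝ, (∫ s in Set.Iic (0 : ℝ), Real.exp s * c) = c := by
    intro c
    rw [integral_mul_const, integral_exp_Iic_zero, one_mul]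
  have hbot : Tendsto G atBot (nhds (-a)) := by
    rw [← hval (-a)]
    refine tendsto_integral_filter_of_dominated_convergence _ (Eventually.of_forall hmeas)
      (Eventually.of_forall fun γ => Eventually.of_forall (hbd γ)) hbint
      (Eventually.of_forall fun s => ?_)
    refine Tendsto.const_mul _ ?_
    have h1 : Tendsto (fun γ : ℝ => s + γ - R (φ s)) atBot atBot := by
      have := tendsto_atBot_add_const_right atBot (s - R (φ s)) (tendsto_id (α := ℝ))
      refine this.congr fun x => ?_
      simp only [id]; ring
    have h2 := (hf.tendsto (-a)).comp (hφbot.comp h1)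
    rw [hfa] at h2
    exact h2
  have htop : Tendsto G atTop (nhds b) := by
    rw [← hval b]
    refine tendsto_integral_filter_of_dominated_convergence _ (Eventually.of_forall hmeas)
      (Eventually.of_forall fun γ => Eventually.of_forall (hbd γ)) hbint
      (Eventually.of_forall fun s => ?_)
    refine Tendsto.const_mul _ ?_
    have h1 : Tendsto (fun γ : ℝ => s + γ - R (φ s)) atTop atTop := by
      have := tendsto_atTop_add_const_right atTop (s - R (φ s)) (tendsto_id (α := ℝ))
      refine this.congr fun x => ?_
      simp only [id]; ring
    have h2 := (hf.tendsto b).comp (hφtop.comp h1)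
    rw [hfb] at h2
    exact h2
  have hGmono : StrictMono G := by
    intro x y hxy
    have hpos : ∀ s : ℝ, 0 < Real.exp s * f (φ (s + y - R (φ s)))
        - Real.exp s * f (φ (s + x - R (φ s))) := by
      intro s
      have h := hg (show s + x - R (φ s) < s + y - R (φ s) by linarith)
      have h' := mul_lt_mul_of_pos_left h (Real.exp_pos s)
      simpa using h'
    have key : 0 < ∫ s in Set.Iic (0 : ℝ), (Real.exp s * f (φ (s + y - R (φ s)))
        - Real.exp s * f (φ (s + x - R (φ s)))) := by
      rw [integral_pos_iff_support_of_nonneg (fun s => (hpos s).le) ((hint y).sub (hint x))]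
      rw [show Function.support (fun s => Real.exp s * f (φ (s + y - R (φ s)))
        - Real.exp s * f (φ (s + x - R (φ s)))) = Set.univ from
          Set.eq_univ_of_forall fun s => (hpos s).ne']
      simp
    rw [integral_sub (hint y) (hint x)] at key
    exact sub_pos.1 key
  obtain ⟨u, hu⟩ := (hbot.eventually_lt_const (show -a < 0 by linarith)).exists
  obtain ⟨v, hv⟩ := (htop.eventually_const_lt hb).exists
  obtain ⟨ρ, hρ⟩ := mem_range_of_exists_le_of_exists_ge hGc ⟨u, hu.le⟩ ⟨v, hv.le⟩
  exact ⟨ρ, hρ, fun y hy => hGmono.injective (Eq.trans hy hρ.symm)⟩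
end

section
/- Let f : ℝ → ℝ be continuous and nondecreasing, let φ : ℝ → ℝ be continuous, bounded and nondecreasing, let R : ℝ → ℝ be continuous, and let ρ ∈ ℝ. Suppose the map s ↦ s − R(φ(s)) is nondecreasing on ℝ. Then the function ψ(t) := ∫_{−∞}^{t} e^{s−t}·f(φ(s + ρ − R(φ(s)))) ds is well defined and nondecreasing on ℝ. -/
open MeasureTheory

lemma tl_integrable (g : ℝ → ℝ) (hg : Continuous g) (C : ℝ) (hC : ∀ s, |g s| ≤ C) (t : ℝ) :
    IntegrableOn (fun s => Real.exp (s - t) * g s) (Set.Iic t) := by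
  have h1 : IntegrableOn (fun s => Real.exp (s - t)) (Set.Iic t) := by
    simp_rw [Real.exp_sub]
    exact (integrableOn_exp_Iic t).div_const _
  exact Integrable.mul_bdd (c := C) h1 hg.aestronglyMeasurable (Filter.Eventually.of_forall hC)

lemma tl_shift (F : ℝ → ℝ) (a b : ℝ) :
    ∫ s in Set.Iic b, F s = ∫ s in Set.Iic a, F (s + (b - a)) := by
  have h := (measurePreserving_add_right (volume : Measure ℝ) (b - a)).setIntegral_preimage_emb
    (measurableEmbedding_addRight (b - a)) F (Set.Iic b)
  rw [← h]
  congr 2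
  ext x
  simp

/-- The transition layer operator preserves monotone profiles: if `f` and `φ`
are nondecreasing, `φ` bounded, and the deviated argument `s ↦ s − R(φ(s))` is
nondecreasing, then `ψ(t) = ∫_{−∞}^{t} e^{s−t}·f(φ(s + ρ − R(φ(s)))) ds` is
well defined and nondecreasing. -/
theorem transition_layer_operator_monotone
    (f : ℝ → ℝ) (hf : Continuous f) (hfmono : Monotone f)
    (φ : ℝ → ℝ) (hφc : Continuous φ)
    (hφb : ∃ C : ℝ, ∀ t : ℝ, |φ t| ≤ C) (hφmono : Monotone φ)
    (R : ℝ → ℝ) (hR : Continuous R) (ρ : ℝ)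
    (hdev : Monotone (fun s => s - R (φ s))) :
    (∀ t : ℝ,
      IntegrableOn (fun s => Real.exp (s - t) * f (φ (s + ρ - R (φ s))))
        (Set.Iic t)) ∧
    Monotone (fun t => ∫ s in Set.Iic t,
      Real.exp (s - t) * f (φ (s + ρ - R (φ s)))) := by
  obtain ⟨C, hC⟩ := hφb
  obtain ⟨g, hgdef⟩ : ∃ g : ℝ → ℝ, g = fun s => f (φ (s + ρ - R (φ s))) := ⟨_, rfl⟩
  have hgc : Continuous g := by rw [hgdef]; fun_prop
  have hgm : Monotone g := by
    intro x y hxy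
    rw [hgdef]
    apply hfmono
    apply hφmono
    have := hdev hxy
    simp only at this
    linarith
  have hgb : ∀ s, |g s| ≤ max |f C| |f (-C)| := by
    intro s
    rw [hgdef]
    have h := abs_le.mp (hC (s + ρ - R (φ s)))
    rw [max_comm]
    exact abs_le_max_abs_abs (hfmono h.1) (hfmono h.2)
  have hgs : ∀ s, f (φ (s + ρ - R (φ s))) = g s := fun s => by rw [hgdef]
  simp only [hgs]
  refine ⟨tl_integrable g hgc _ hgb, ?_⟩
  intro a b hab
  simp only
  rw [tl_shift _ a b]
  have he : ∀ s : ℝ, s + (b - a) - b = s - a := fun s => by ring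
  simp only [he]
  refine integral_mono (tl_integrable g hgc _ hgb a)
    (tl_integrable (fun s => g (s + (b - a))) (by fun_prop) _ (fun s => hgb _) a) ?_
  intro s
  exact mul_le_mul_of_nonneg_left (hgm (by linarith)) (Real.exp_pos _).le
end
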